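/- Repulsion for twists by Dirichlet characters (Proposition 5.3): For every κ > 0 there is a constant C = C(κ) > 0 such that the following holds. Let f belong to the class C(κ); let q ≥ 1 be a natural number and let χ₁, …, χ_J be distinct Dirichlet characters mod q; let t₁, …, t_J be real numbers with |t_j| ≤ (log x)^κ for all j; let δ₁, …, δ_J ≥ 0 be real numbers; let x ≥ 10 be real and let y be real with q·log x ≤ y ≤ √x. Then min_{1 ≤ j ≤ J} log | ℒ_{χ_j}(1 + 1/log x + δ_j + i·t_j) | ≤ (κ/√J)·( log( log x / log y ) + C·J ), where for a Dirichlet character χ mod q one sets ℒ_χ(w) = ∑ over n ≥ 1 all of whose prime factors exceed y (including n = 1) of f(n)·χ(n)·n^{−w}. -/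

import Mathlib

open Complex MeasureTheory
open scoped Classical

noncomputable section

/-- Membership of `f` in the class `C(κ)`, witnessed by `Λf`. -/
structure IsHalaszClass (κ : ℝ) (f : ℕ → ℂ) (Λf : ℕ → ℂ) : Prop where
  map_one : f 1 = 1
  mult : ∀ m n : ℕ, Nat.Coprime m n → f (m * n) = f m * f n
  supp : ∀ n : ℕ, ¬ IsPrimePow n → Λf n = 0
  bound : ∀ n : ℕ, 1 ≤ n → ‖Λf n‖ ≤ κ * ArithmeticFunction.vonMangoldt n
  conv : ∀ n : ℕ, 1 ≤ n →
    f n * (Real.log n : ℂ) = ∑ d ∈ n.divisors, Λf d * f (n / d)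
  abs_conv : ∀ σ : ℝ, 1 < σ → Summable (fun n : ℕ => ‖f n‖ / (n : ℝ) ^ σ)

/-- The Dirichlet series `F(s) = ∑ f(n) n^{-s}`. -/
def Fser (f : ℕ → ℂ) (s : ℂ) : ℂ := ∑' n : ℕ, f n / (n : ℂ) ^ s

/-- `ℒ_χ(w) = ∑_{n : p(n) > y} f(n) χ(n) n^{-w}` (the `n = 1` term included). -/
def Lchi {q : ℕ} (f : ℕ → ℂ) (χ : DirichletCharacter ℂ q) (y : ℝ) (w : ℂ) : ℂ :=
  ∑' n : ℕ,
    (if ∀ p ∈ n.primeFactors, y < (p : ℝ) then f n * χ (n : ZMod q) else 0) / (n : ℂ) ^ w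

/-- A function analytic on a neighbourhood of a closed disc and not vanishing identically there is
a polynomial with roots in the disc times an analytic function without zeros. -/
lemma exists_eq_prod_mul_of_analyticOnNhd {G : ℂ → ℂ} {R : ℝ} (hR : 0 < R)
    (hG : AnalyticOnNhd ℂ G (Metric.closedBall 0 R))
    (hne : ∃ z ∈ Metric.closedBall (0 : ℂ) R, G z ≠ 0) :
    ∃ (S : Finset ℂ) (m : ℂ → ℕ) (g : ℂ → ℂ), (∀ u ∈ S, u ∈ Metric.closedBall (0 : ℂ) R) ∧
      (∀ u ∈ S, m u ≠ 0) ∧ AnalyticOnNhd ℂ g (Metric.closedBall 0 R) ∧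
      (∀ z ∈ Metric.closedBall (0 : ℂ) R, g z ≠ 0) ∧
      ∀ z ∈ Metric.closedBall (0 : ℂ) R, G z = (∏ u ∈ S, (z - u) ^ m u) * g z := by
  have hmer : MeromorphicOn G (Metric.closedBall 0 R) := hG.meromorphicOn
  have hconv : Convex ℝ (Metric.closedBall (0 : ℂ) R) := convex_closedBall 0 R
  have hfin : (MeromorphicOn.divisor G (Metric.closedBall 0 R)).support.Finite :=
    Function.locallyFinsuppWithin.finiteSupport _ (isCompact_closedBall 0 R)
  have htop : ∀ u : Metric.closedBall (0 : ℂ) R, meromorphicOrderAt G u ≠ ⊤ := by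
    intro u hu
    rw [meromorphicOrderAt_eq_top_iff] at hu
    obtain ⟨z, hz, hGz⟩ := hne
    exact hGz (hG.eqOn_zero_of_preconnected_of_frequently_eq_zero hconv.isPreconnected u.2
      hu.frequently hz)
  obtain ⟨g, hg, hg0, hEq⟩ := hmer.extract_zeros_poles htop hfin
  set D := MeromorphicOn.divisor G (Metric.closedBall 0 R) with hD
  have hD0 : ∀ u, 0 ≤ D u := fun u => MeromorphicOn.AnalyticOnNhd.divisor_nonneg hG u
  refine ⟨hfin.toFinset, fun u => (D u).toNat, g, ?_, ?_, hg, fun z hz => hg0 ⟨z, hz⟩, ?_⟩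
  · intro u hu
    exact D.supportWithinDomain (by simpa using hu)
  · intro u hu
    have h1 : D u ≠ 0 := by simpa using hu
    have := hD0 u
    simp only [ne_eq, Int.toNat_eq_zero, not_le]
    omega
  · intro z hz
    have hprod : ∀ z, (∏ᶠ u, (fun w : ℂ => w - u) ^ D u) z
        = ∏ u ∈ hfin.toFinset, (z - u) ^ (D u).toNat := by
      intro z
      rw [finprod_eq_prod_of_mulSupport_subset_of_finite _ _ hfin, Finset.prod_apply]
      · refine Finset.prod_congr rfl fun u _ => ?_
        simp only [Pi.pow_apply]
        conv_lhs => rw [← Int.toNat_of_nonneg (hD0 u)]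
        rw [zpow_natCast]
      · intro u hu
        simp only [Function.mem_mulSupport] at hu
        simp only [Function.mem_support]
        intro h
        exact hu (by rw [h, zpow_zero])
    have hcont : ContinuousAt (fun z => (∏ u ∈ hfin.toFinset, (z - u) ^ (D u).toNat) * g z) z := by
      have := (hg z hz).continuousAt
      fun_prop
    have hz' : z ∈ closure (Metric.ball (0 : ℂ) R \ {z}) := by
      have : AccPt z (Filter.principal (Metric.ball (0 : ℂ) R)) := by
        have hpre : IsPreconnected (Metric.closedBall (0 : ℂ) R) := hconv.isPreconnected
        rw [accPt_iff_frequently_nhdsNE]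
        have h1 : z ∈ closure (Metric.ball (0 : ℂ) R) := by rwa [closure_ball _ hR.ne']
        by_cases hzb : z ∈ Metric.ball (0 : ℂ) R
        · exact (Filter.Eventually.filter_mono nhdsWithin_le_nhds
            (Metric.isOpen_ball.mem_nhds hzb)).frequently
        · rw [mem_closure_iff_frequently] at h1
          rw [frequently_nhdsWithin_iff]
          refine h1.mono fun w hw => ⟨hw, ?_⟩
          rintro rfl
          exact hzb hw
      rwa [accPt_principal_iff_clusterPt, ← mem_closure_iff_clusterPt] at this
    rw [mem_closure_iff_nhdsWithin_neBot] at hz'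
    refine tendsto_nhds_unique_of_eventuallyEq (l := nhdsWithin z (Metric.ball (0 : ℂ) R \ {z}))
      ((hG z hz).continuousAt.tendsto.mono_left nhdsWithin_le_nhds)
      (hcont.tendsto.mono_left nhdsWithin_le_nhds) ?_
    have h2 := (mem_codiscreteWithin_iff_forall_mem_nhdsNE.1 hEq) z hz
    rw [Filter.EventuallyEq, eventually_nhdsWithin_iff]
    have h3 := eventually_nhdsWithin_iff.1 (Filter.eventually_iff.2 h2)
    filter_upwards [h3] with w hw hwm
    rcases hw hwm.2 with h | h
    · have h4 : G w = (∏ᶠ u, (fun w : ℂ => w - u) ^ D u) w * g w := h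
      rw [h4, hprod]
    · exact absurd (Metric.ball_subset_closedBall hwm.1) h

/-- Harnack-type inequality for a zero-free holomorphic function bounded by one. -/
lemma log_norm_le_of_ne_zero {H : ℂ → ℂ} {c : ℂ} {r : ℝ} (hr : 0 < r)
    (hH : DifferentiableOn ℂ H (Metric.ball c r)) (h0 : ∀ z ∈ Metric.ball c r, H z ≠ 0)
    (h1 : ∀ z ∈ Metric.ball c r, ‖H z‖ ≤ 1) {a : ℂ} (ha : dist a c ≤ r / 2) :
    Real.log ‖H a‖ ≤ (1 - 4 * dist a c / r) * Real.log ‖H c‖ := by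
  have hc : c ∈ Metric.ball c r := Metric.mem_ball_self hr
  have haB : a ∈ Metric.ball c r := by rw [Metric.mem_ball]; linarith
  have hquot : DifferentiableOn ℂ (fun z => deriv H z / H z) (Metric.ball c r) :=
    (hH.deriv Metric.isOpen_ball).div hH h0
  obtain ⟨h, hhc, hh⟩ := hquot.isExactOn_ball.with_val_at c 0
  have hconst : ∀ z ∈ Metric.ball c r, H z = H c * exp (h z) := by
    have hd : ∀ z ∈ Metric.ball c r, HasDerivAt (fun z => H z * exp (-h z)) 0 z := by
      intro z hz
      have e1 := (hH.differentiableAt (Metric.isOpen_ball.mem_nhds hz)).hasDerivAt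
      have e2 := (hh z hz).neg.cexp
      convert! e1.mul e2 using 1
      field_simp [h0 z hz]
      ring
    intro z hz
    have := Metric.isOpen_ball.is_const_of_deriv_eq_zero (convex_ball c r).isPreconnected
      (fun z hz => (hd z hz).differentiableAt.differentiableWithinAt)
      (fun z hz => (hd z hz).deriv) hz hc
    simp only [hhc, neg_zero, exp_zero, mul_one] at this
    rw [← this, mul_assoc, ← exp_add]
    simp
  have hlog : ∀ z ∈ Metric.ball c r, Real.log ‖H z‖ = Real.log ‖H c‖ + (h z).re := by
    intro z hz
    rw [hconst z hz, norm_mul, Real.log_mul (norm_ne_zero_iff.2 (h0 c hc))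
      (norm_ne_zero_iff.2 (exp_ne_zero _)), norm_exp, Real.log_exp]
  have hneg : ∀ z ∈ Metric.ball c r, Real.log ‖H z‖ ≤ 0 := fun z hz =>
    Real.log_nonpos (norm_nonneg _) (h1 z hz)
  set d := dist a c with hd
  have hd0 : 0 ≤ d := dist_nonneg
  have key : ∀ M, -Real.log ‖H c‖ < M → (h a).re ≤ 4 * d / r * M := by
    intro M hM
    have hMpos : 0 < M := by linarith [hneg c hc]
    have hb := borelCaratheodory_zero (f := fun z => h (c + z)) (M := M) (R := r) (z := a - c) hMpos
      (fun z hz => by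
        have hz' : c + z ∈ Metric.ball c r := by simpa [dist_eq_norm] using hz
        exact ((hh _ hz').comp_const_add c z).differentiableAt.differentiableWithinAt)
      (fun z hz => by
        have hz' : c + z ∈ Metric.ball c r := by simpa [dist_eq_norm] using hz
        have e1 := hlog _ hz'
        have e2 := hneg _ hz'
        simp only [Set.mem_ofPred_eq]
        linarith) hr
      (by simpa [dist_eq_norm] using haB) (by simp [hhc])
    simp only [add_sub_cancel] at hb
    rw [← dist_eq_norm, ← hd] at hb
    refine (re_le_norm _).trans (hb.trans ?_)
    rw [div_le_iff₀ (by linarith)]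
    have : 4 * d / r * M * (r - d) = 2 * M * d * (2 * (r - d) / r) := by ring
    rw [this]
    refine le_mul_of_one_le_right (by positivity) ?_
    rw [le_div_iff₀ hr]
    linarith
  have h2 : (h a).re ≤ 4 * d / r * (-Real.log ‖H c‖) := by
    have : Filter.Tendsto (fun M => 4 * d / r * M) (nhdsWithin (-Real.log ‖H c‖)
        (Set.Ioi (-Real.log ‖H c‖))) (nhds (4 * d / r * (-Real.log ‖H c‖))) :=
      (Continuous.tendsto (by fun_prop) _).mono_left nhdsWithin_le_nhds
    exact ge_of_tendsto this (Filter.eventually_of_mem self_mem_nhdsWithin fun M hM => key M hM)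
  rw [hlog a haB]
  linarith

lemma normSq_sq_sub_conj_mul (R s : ℝ) (u : ℂ) :
    normSq (R ^ 2 - (starRingEnd ℂ) u * s)
      = R ^ 4 - 2 * R ^ 2 * u.re * s + (u.re ^ 2 + u.im ^ 2) * s ^ 2 := by
  have h1 : ((R : ℂ) ^ 2) = ((R ^ 2 : ℝ) : ℂ) := by push_cast; rfl
  have h2 : R ^ 4 = (R ^ 2) ^ 2 := by ring
  rw [h1, h2]
  generalize R ^ 2 = r
  rw [normSq_apply]
  simp
  ring

lemma normSq_mul_sub (R s : ℝ) (u : ℂ) :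
    normSq (R * (s - u)) = R ^ 2 * (s ^ 2 - 2 * s * u.re + (u.re ^ 2 + u.im ^ 2)) := by
  rw [normSq_apply]
  simp
  ring

/-- The Blaschke factor with zero `u` in the left half of a disc increases along the positive real
radius. -/
lemma blaschke_norm_le {R a b : ℝ} {u : ℂ} (ha : 0 ≤ a) (hab : a ≤ b) (hbR : b < R)
    (hu : ‖u‖ ≤ R) (hre : u.re ≤ 0) :
    ‖R * (a - u) / (R ^ 2 - (starRingEnd ℂ) u * a)‖
      ≤ ‖R * (b - u) / (R ^ 2 - (starRingEnd ℂ) u * b)‖ := by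
  have hRpos : 0 < R := by linarith
  have hu2 : u.re ^ 2 + u.im ^ 2 ≤ R ^ 2 := by
    have := pow_le_pow_left₀ (norm_nonneg u) hu 2
    rw [Complex.sq_norm, normSq_apply] at this
    nlinarith
  have hden : ∀ s : ℝ, 0 ≤ s → s < R → 0 < normSq (R ^ 2 - (starRingEnd ℂ) u * s) := by
    intro s hs hsR
    rw [normSq_pos, sub_ne_zero]
    intro h
    have h2 := congrArg (fun z => ‖z‖) h
    simp only [norm_pow, norm_real, Real.norm_eq_abs, norm_mul, RCLike.norm_conj, abs_of_pos hRpos,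
      abs_of_nonneg hs] at h2
    nlinarith [norm_nonneg u]
  have hda := hden a ha (hab.trans_lt hbR)
  have hdb := hden b (ha.trans hab) hbR
  rw [← sq_le_sq₀ (norm_nonneg _) (norm_nonneg _), Complex.sq_norm, Complex.sq_norm, normSq_div,
    normSq_div, div_le_div_iff₀ hda hdb]
  simp only [normSq_sq_sub_conj_mul, normSq_mul_sub]
  set w := u.re ^ 2 + u.im ^ 2 with hw
  have hw0 : 0 ≤ w := by positivity
  have hb0 : 0 ≤ b := ha.trans hab
  have hid : R ^ 2 * (b ^ 2 - 2 * b * u.re + w) * (R ^ 4 - 2 * R ^ 2 * u.re * a + w * a ^ 2)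
      - R ^ 2 * (a ^ 2 - 2 * a * u.re + w) * (R ^ 4 - 2 * R ^ 2 * u.re * b + w * b ^ 2)
      = R ^ 2 * (R ^ 2 - w) * (b - a) * ((b + a) * (R ^ 2 + w) + (-2 * u.re) * (R ^ 2 + a * b)) := by
    ring
  have : 0 ≤ R ^ 2 * (R ^ 2 - w) * (b - a)
      * ((b + a) * (R ^ 2 + w) + (-2 * u.re) * (R ^ 2 + a * b)) := by
    have i1 : 0 ≤ R ^ 2 - w := by linarith
    have i2 : 0 ≤ b - a := by linarith
    have i3 : 0 ≤ -2 * u.re := by linarith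
    positivity
  linarith

/-- Let `G` be analytic and bounded by one on a disc, with all zeros in the left half of the disc.
Then moving to the left along the positive real radius hardly increases `log ‖G‖`. -/
lemma log_norm_le_of_zeros_left {G : ℂ → ℂ} {R : ℝ} (hR : 0 < R)
    (hG : AnalyticOnNhd ℂ G (Metric.closedBall 0 R))
    (h1 : ∀ z ∈ Metric.closedBall (0 : ℂ) R, ‖G z‖ ≤ 1)
    (hz : ∀ z ∈ Metric.closedBall (0 : ℂ) R, G z = 0 → z.re ≤ 0) {a b : ℝ} (ha : 0 < a)
    (hab : a ≤ b) (hb : b ≤ R / 4) :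
    Real.log ‖G a‖ ≤ (1 - 8 * (b - a) / R) * Real.log ‖G b‖ := by
  have hmem : ∀ s : ℝ, 0 < s → s ≤ R / 4 → (s : ℂ) ∈ Metric.closedBall (0 : ℂ) R := by
    intro s hs hsR
    simp only [mem_closedBall_zero_iff, norm_real, Real.norm_eq_abs, abs_of_pos hs]
    linarith
  have hbpos : 0 < b := ha.trans_le hab
  have hGne : ∀ s : ℝ, 0 < s → s ≤ R / 4 → G s ≠ 0 := by
    intro s hs hsR h
    have := hz _ (hmem s hs hsR) h
    simp at this
    linarith
  obtain ⟨S, m, g, hS, hm, hg, hg0, hfac⟩ :=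
    exists_eq_prod_mul_of_analyticOnNhd hR hG ⟨b, hmem b hbpos hb, hGne b hbpos hb⟩
  have hSre : ∀ u ∈ S, u.re ≤ 0 := by
    intro u hu
    refine hz u (hS u hu) ?_
    rw [hfac u (hS u hu), Finset.prod_eq_zero hu (by simp [hm u hu]), zero_mul]
  set H : ℂ → ℂ := fun z => (∏ u ∈ S, ((R ^ 2 - (starRingEnd ℂ) u * z) / R) ^ m u) * g z with hH
  have hHan : AnalyticOnNhd ℂ H (Metric.closedBall 0 R) := by
    intro z hz
    have := hg z hz
    have : AnalyticAt ℂ (fun z => ∏ u ∈ S, ((R ^ 2 - (starRingEnd ℂ) u * z) / R) ^ m u) z :=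
      Finset.analyticAt_fun_prod _ fun u _ => by fun_prop
    exact this.mul (hg z hz)
  have hden : ∀ u ∈ S, ∀ z ∈ Metric.ball (0 : ℂ) R, (R ^ 2 - (starRingEnd ℂ) u * z : ℂ) ≠ 0 := by
    intro u hu z hz
    rw [sub_ne_zero]
    intro h
    have h2 := congrArg (fun z => ‖z‖) h
    have h3 := hS u hu
    simp only [mem_closedBall_zero_iff, mem_ball_zero_iff] at h3 hz
    simp only [norm_pow, norm_real, Real.norm_eq_abs, norm_mul, RCLike.norm_conj,
      abs_of_pos hR] at h2
    nlinarith [norm_nonneg u, norm_nonneg z]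
  have hRc : (R : ℂ) ≠ 0 := by exact_mod_cast hR.ne'
  have hH0 : ∀ z ∈ Metric.ball (0 : ℂ) R, H z ≠ 0 := by
    intro z hz
    refine mul_ne_zero (Finset.prod_ne_zero_iff.2 fun u hu => pow_ne_zero _ ?_)
      (hg0 z (Metric.ball_subset_closedBall hz))
    exact div_ne_zero (hden u hu z hz) hRc
  have hHle : ∀ z ∈ Metric.ball (0 : ℂ) R, ‖H z‖ ≤ 1 := by
    intro z hz
    refine norm_le_of_forall_mem_frontier_norm_le (U := Metric.ball 0 R) Metric.isBounded_ball
      ?_ ?_ (subset_closure hz)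
    · refine ⟨fun w hw => (hHan w (Metric.ball_subset_closedBall hw)).differentiableAt.differentiableWithinAt, ?_⟩
      rw [closure_ball _ hR.ne']
      exact hHan.continuousOn
    · intro w hw
      rw [frontier_ball _ hR.ne'] at hw
      have hwc := Metric.sphere_subset_closedBall hw
      have : ‖H w‖ = ‖G w‖ := by
        rw [hfac w hwc, hH]
        simp only [norm_mul, norm_prod, norm_pow, norm_div]
        congr 1
        refine Finset.prod_congr rfl fun u _ => ?_
        congr 1
        have hwn : ‖w‖ = R := by simpa using hw
        have e : (R ^ 2 - (starRingEnd ℂ) u * w : ℂ) = w * (starRingEnd ℂ) (w - u) := by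
          rw [map_sub, mul_sub, mul_conj, normSq_eq_norm_sq, hwn]
          push_cast
          ring
        rw [e, norm_mul, RCLike.norm_conj, hwn, norm_real, Real.norm_eq_abs, abs_of_pos hR]
        field_simp
      rw [this]
      exact h1 w hwc
  set B : ℝ → ℝ := fun s =>
    ∏ u ∈ S, ‖(R * (s - u) / (R ^ 2 - (starRingEnd ℂ) u * s) : ℂ)‖ ^ m u with hB
  have hGBH : ∀ s : ℝ, 0 < s → s ≤ R / 4 → ‖G s‖ = B s * ‖H s‖ := by
    intro s hs hsR
    have hsb : (s : ℂ) ∈ Metric.ball (0 : ℂ) R := by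
      simp only [mem_ball_zero_iff, norm_real, Real.norm_eq_abs, abs_of_pos hs]
      linarith
    rw [hfac s (hmem s hs hsR), hB, hH]
    simp only [norm_mul, norm_prod, norm_pow]
    rw [← mul_assoc, ← Finset.prod_mul_distrib]
    congr 1
    refine Finset.prod_congr rfl fun u hu => ?_
    rw [← mul_pow, ← norm_mul]
    congr 2
    rw [div_mul_div_cancel₀ (hden u hu s hsb), mul_div_cancel_left₀ _ hRc]
  have hsb : ∀ s : ℝ, 0 < s → s ≤ R / 4 → (s : ℂ) ∈ Metric.ball (0 : ℂ) R := by
    intro s hs hsR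
    simp only [mem_ball_zero_iff, norm_real, Real.norm_eq_abs, abs_of_pos hs]
    linarith
  have haR : a ≤ R / 4 := hab.trans hb
  have hBne : ∀ s : ℝ, 0 < s → s ≤ R / 4 → 0 < B s := by
    intro s hs hsR
    have h2 := hGne s hs hsR
    rw [← norm_ne_zero_iff, hGBH s hs hsR] at h2
    exact lt_of_le_of_ne (Finset.prod_nonneg fun u _ => by positivity) (left_ne_zero_of_mul h2).symm
  have hBab : B a ≤ B b := by
    refine Finset.prod_le_prod (fun u _ => by positivity) fun u hu => ?_
    exact pow_le_pow_left₀ (norm_nonneg _)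
      (blaschke_norm_le ha.le hab (by linarith) (by simpa using hS u hu) (hSre u hu)) _
  have hBb1 : B b ≤ 1 := by
    refine Finset.prod_le_one (fun u _ => by positivity) fun u hu => ?_
    refine pow_le_one₀ (norm_nonneg _) ?_
    have hu' : ‖u‖ ≤ R := by simpa using hS u hu
    rcases eq_or_ne u 0 with rfl | hu0
    · simp only [sub_zero, map_zero, zero_mul, norm_div, norm_mul, norm_real, Real.norm_eq_abs,
        norm_pow, abs_of_pos hR, abs_of_pos hbpos]
      rw [div_le_one (by positivity)]
      nlinarith
    · have hd := norm_pos_iff.2 (hden u hu b (hsb b hbpos hb))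
      rw [norm_div, div_le_one hd, ← sq_le_sq₀ (norm_nonneg _) (norm_nonneg _), Complex.sq_norm,
        Complex.sq_norm]
      rw [normSq_sq_sub_conj_mul, normSq_mul_sub]
      have hu2 : u.re ^ 2 + u.im ^ 2 ≤ R ^ 2 := by
        have := pow_le_pow_left₀ (norm_nonneg u) hu' 2
        rw [Complex.sq_norm, normSq_apply] at this
        nlinarith
      have : 0 ≤ (R ^ 2 - b ^ 2) * (R ^ 2 - (u.re ^ 2 + u.im ^ 2)) :=
        mul_nonneg (by nlinarith) (by linarith)
      nlinarith
  have hHb := hH0 b (hsb b hbpos hb)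
  have hHa := hH0 a (hsb a ha haR)
  have hsub : Metric.ball (b : ℂ) (R / 2) ⊆ Metric.ball (0 : ℂ) R := by
    refine Metric.ball_subset_ball' ?_
    simp only [dist_zero_right, norm_real, Real.norm_eq_abs, abs_of_pos hbpos]
    linarith
  have hdist : dist (a : ℂ) b = b - a := by
    rw [dist_eq_norm, ← ofReal_sub, norm_real, Real.norm_eq_abs, abs_of_nonpos (by linarith)]
    ring
  have hHar := log_norm_le_of_ne_zero (c := b) (r := R / 2) (a := a) (by positivity)
    (fun z hz => (hHan z (Metric.ball_subset_closedBall (hsub hz))).differentiableAt.differentiableWithinAt)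
    (fun z hz => hH0 z (hsub hz)) (fun z hz => hHle z (hsub hz)) (by rw [hdist]; linarith)
  rw [hdist] at hHar
  have e3 : 4 * (b - a) / (R / 2) = 8 * (b - a) / R := by field_simp; ring
  rw [e3] at hHar
  rw [hGBH a ha haR, hGBH b hbpos hb, Real.log_mul (hBne a ha haR).ne' (norm_ne_zero_iff.2 hHa),
    Real.log_mul (hBne b hbpos hb).ne' (norm_ne_zero_iff.2 hHb)]
  have i1 : Real.log (B a) ≤ Real.log (B b) := Real.log_le_log (hBne a ha haR) hBab
  have i2 : Real.log (B b) ≤ 0 := Real.log_nonpos (hBne b hbpos hb).le hBb1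
  have i3 : 0 ≤ 8 * (b - a) / R := div_nonneg (by linarith) hR.le
  nlinarith

lemma sum_range_dirichletCharacter_eq_zero {q : ℕ} [NeZero q] {χ : DirichletCharacter ℂ q}
    (hχ : χ ≠ 1) : ∑ k ∈ Finset.range q, χ (k : ZMod q) = 0 := by
  rw [← MulChar.sum_eq_zero_of_ne_one hχ]
  refine Finset.sum_nbij' (fun k => (k : ZMod q)) ZMod.val ?_ ?_ ?_ ?_ ?_
  · simp
  · intro a _
    simpa using ZMod.val_lt a
  · intro k hk
    exact ZMod.val_cast_of_lt (by simpa using hk)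
  · intro a _
    simp
  · simp

lemma norm_sum_range_dirichletCharacter_le {q : ℕ} [NeZero q] {χ : DirichletCharacter ℂ q}
    (hχ : χ ≠ 1) (n : ℕ) : ‖∑ k ∈ Finset.range n, χ (k : ZMod q)‖ ≤ q := by
  induction n using Nat.strong_induction_on with
  | _ n ih =>
    rcases lt_or_ge n q with h | h
    · calc ‖∑ k ∈ Finset.range n, χ (k : ZMod q)‖ ≤ ∑ k ∈ Finset.range n, (1 : ℝ) :=
            norm_sum_le_of_le _ fun k _ => χ.norm_le_one _
        _ ≤ q := by simpa using h.le
    · obtain ⟨m, rfl⟩ := Nat.exists_eq_add_of_le h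
      rw [Finset.sum_range_add, sum_range_dirichletCharacter_eq_zero hχ, zero_add]
      simpa using ih m (by have := NeZero.pos q; omega)

lemma norm_sum_Icc_dirichletCharacter_le {q : ℕ} [NeZero q] {χ : DirichletCharacter ℂ q}
    (hχ : χ ≠ 1) (n : ℕ) : ‖∑ k ∈ Finset.Icc 1 n, χ (k : ZMod q)‖ ≤ q := by
  have hq : q ≠ 1 := by
    rintro rfl
    exact hχ (DirichletCharacter.level_one χ)
  have h0 : χ ((0 : ℕ) : ZMod q) = 0 := by
    have : Fact (1 < q) := ⟨by have := NeZero.pos q; omega⟩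
    rw [Nat.cast_zero]
    exact χ.map_zero
  have := norm_sum_range_dirichletCharacter_le hχ (n + 1)
  rwa [Finset.range_eq_Ico, ← Finset.sum_erase (Finset.Ico 0 (n + 1)) (f := fun k : ℕ => χ (k : ZMod q)) h0,
    show (Finset.Ico 0 (n + 1)).erase 0 = Finset.Icc 1 n by ext; simp; omega] at this

lemma mellin_eq_integral_Ioi_one {A : ℝ → ℂ} (hA : ∀ t < 1, A t = 0) (s : ℂ) :
    mellin A s = ∫ t in Set.Ioi (1 : ℝ), (t : ℂ) ^ (s - 1) • A t := by
  rw [mellin, ← integral_Ici_eq_integral_Ioi (x := 1),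
    ← setIntegral_eq_of_subset_of_forall_sdiff_eq_zero measurableSet_Ioi
      (Set.Ici_subset_Ioi.mpr one_pos)]
  intro t ht
  rw [hA t (by simpa using ht.2), smul_zero]

/-- Partial summation: `L(s, χ) = s ∫₁^∞ (∑_{k ≤ t} χ(k)) t^{-s-1} dt` in `Re s > 0`. -/
lemma LFunction_eq_mul_mellin {q : ℕ} [NeZero q] {χ : DirichletCharacter ℂ q} (hχ : χ ≠ 1)
    {s : ℂ} (hs : 0 < s.re) :
    χ.LFunction s = s * mellin (fun t : ℝ => ∑ k ∈ Finset.Icc 1 ⌊t⌋₊, χ (k : ZMod q)) (-s) := by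
  set A : ℝ → ℂ := fun t : ℝ => ∑ k ∈ Finset.Icc 1 ⌊t⌋₊, χ (k : ZMod q) with hA
  have hAq : ∀ t, ‖A t‖ ≤ q := fun t => norm_sum_Icc_dirichletCharacter_le hχ _
  have hmeas : Measurable A :=
    (measurable_from_nat (f := fun n => ∑ k ∈ Finset.Icc 1 n, χ (k : ZMod q))).comp
      Nat.measurable_floor
  have hloc : LocallyIntegrableOn A (Set.Ioi 0) := by
    refine LocallyIntegrable.locallyIntegrableOn ?_ _
    refine (locallyIntegrable_const (q : ℝ)).mono hmeas.aestronglyMeasurable ?_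
    filter_upwards with t
    simpa using hAq t
  have hdiff : DifferentiableOn ℂ (fun s => s * mellin A (-s)) {s | 0 < s.re} := by
    intro s hs
    have hs : 0 < s.re := hs
    have := mellin_differentiableAt_of_isBigO_rpow (a := 0) (b := -s.re - 1) (s := -s) hloc
      (by
        simp only [neg_zero, Real.rpow_zero]
        exact Asymptotics.IsBigO.of_bound q (by filter_upwards with t; simpa using hAq t))
      (by simpa using hs)
      (by
        refine Asymptotics.IsBigO.of_bound 0 ?_
        have : Set.Iio (1 : ℝ) ∈ nhdsWithin (0 : ℝ) (Set.Ioi 0) :=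
          mem_nhdsWithin_of_mem_nhds (Iio_mem_nhds one_pos)
        filter_upwards [this] with t ht
        simp [hA, Nat.floor_eq_zero.mpr (Set.mem_Iio.mp ht)])
      (by simp)
    have h2 : DifferentiableAt ℂ (fun s => mellin A (-s)) s :=
      DifferentiableAt.comp (g := mellin A) s this differentiable_neg.differentiableAt
    exact (differentiableAt_id.mul h2).differentiableWithinAt
  have hopen : IsOpen {s : ℂ | 0 < s.re} := isOpen_lt continuous_const continuous_re
  have hconn : IsPreconnected {s : ℂ | 0 < s.re} := (convex_halfSpace_re_gt 0).isPreconnected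
  refine AnalyticOnNhd.eqOn_of_preconnected_of_eventuallyEq (z₀ := 2)
    ((DirichletCharacter.differentiable_LFunction hχ).differentiableOn.analyticOnNhd hopen)
    (hdiff.analyticOnNhd hopen) hconn (by simp) ?_ hs
  have : {s : ℂ | 1 < s.re} ∈ nhds (2 : ℂ) :=
    (isOpen_lt continuous_const continuous_re).mem_nhds (by simp)
  filter_upwards [this] with s hs
  have hs : 1 < s.re := hs
  rw [DirichletCharacter.LFunction_eq_LSeries χ hs,
    LSeries_eq_mul_integral _ le_rfl (by linarith)
      (DirichletCharacter.LSeriesSummable_of_one_lt_re χ hs)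
      (by
        simp only [Real.rpow_zero]
        exact Asymptotics.IsBigO.of_bound q (by
          filter_upwards with n
          simpa using norm_sum_Icc_dirichletCharacter_le hχ n))]
  congr 1
  rw [mellin_eq_integral_Ioi_one fun t ht => ?_]
  · refine setIntegral_congr_fun measurableSet_Ioi fun t _ => ?_
    simp [hA, mul_comm, sub_eq_add_neg, add_comm]
  · simp [hA, Nat.floor_eq_zero.mpr ht]

lemma norm_LFunction_le {q : ℕ} [NeZero q] {χ : DirichletCharacter ℂ q} (hχ : χ ≠ 1)
    {s : ℂ} (hs : 1 / 2 ≤ s.re) : ‖χ.LFunction s‖ ≤ 2 * q * ‖s‖ := by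
  rw [LFunction_eq_mul_mellin hχ (by linarith), norm_mul, mul_comm]
  gcongr
  have hq : (0 : ℝ) ≤ q := Nat.cast_nonneg q
  rw [mellin_eq_integral_Ioi_one fun t ht => by simp [Nat.floor_eq_zero.mpr ht]]
  calc ‖∫ t in Set.Ioi (1 : ℝ), (t : ℂ) ^ (-s - 1) • ∑ k ∈ Finset.Icc 1 ⌊t⌋₊, χ (k : ZMod q)‖
      ≤ ∫ t in Set.Ioi (1 : ℝ), q * t ^ (-(3 / 2) : ℝ) := by
        refine norm_integral_le_of_norm_le
          ((integrableOn_Ioi_rpow_of_lt (by norm_num) one_pos).const_mul _) ?_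
        filter_upwards [ae_restrict_mem measurableSet_Ioi] with t ht
        have ht : 1 < t := ht
        rw [norm_smul, mul_comm, norm_cpow_eq_rpow_re_of_pos (by linarith)]
        gcongr
        · exact norm_sum_Icc_dirichletCharacter_le hχ _
        · exact ht.le
        · simp; linarith
    _ = 2 * q := by
        rw [integral_const_mul, integral_Ioi_rpow_of_lt (by norm_num) one_pos]
        norm_num; ring

lemma abscissaOfAbsConv_div_log_le {Λg : ℕ → ℂ} {κ : ℝ} (hκ : 0 ≤ κ)
    (hΛ : ∀ n ≠ 0, ‖Λg n‖ ≤ κ * ArithmeticFunction.vonMangoldt n) :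
    LSeries.abscissaOfAbsConv (fun n => Λg n / Real.log n) ≤ 1 := by
  refine LSeries.abscissaOfAbsConv_le_of_le_const ⟨κ, fun n hn => ?_⟩
  have hl : 0 ≤ Real.log n := Real.log_natCast_nonneg n
  rw [norm_div, norm_real, Real.norm_of_nonneg hl]
  refine div_le_of_le_mul₀ hl hκ ((hΛ n hn).trans ?_)
  gcongr
  exact ArithmeticFunction.vonMangoldt_le_log

/-- If `g n log n = ∑_{d ∣ n} Λg(d) g(n / d)`, then the Dirichlet series of `g` is the exponential
of that of `Λg(n) / log n`. -/
lemma LSeries_eq_exp_LSeries_div_log {g Λg : ℕ → ℂ} {κ : ℝ} (hκ : 0 ≤ κ) (h1 : g 1 = 1)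
    (hconv : ∀ n ≠ 0, g n * (Real.log n : ℂ) = ∑ d ∈ n.divisors, Λg d * g (n / d))
    (hg : LSeries.abscissaOfAbsConv g ≤ 1)
    (hΛ : ∀ n ≠ 0, ‖Λg n‖ ≤ κ * ArithmeticFunction.vonMangoldt n) {s : ℂ} (hs : 1 < s.re) :
    LSeries g s = exp (LSeries (fun n => Λg n / Real.log n) s) := by
  set h : ℕ → ℂ := fun n => Λg n / Real.log n with hh
  have hha : LSeries.abscissaOfAbsConv h ≤ 1 := abscissaOfAbsConv_div_log_le hκ hΛ
  have hlt : ∀ {F : ℕ → ℂ}, LSeries.abscissaOfAbsConv F ≤ 1 → ∀ {z : ℂ}, 1 < z.re →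
      LSeries.abscissaOfAbsConv F < z.re := fun hF z hz => hF.trans_lt (by exact_mod_cast hz)
  have hΛ1 : Λg 1 = 0 := by
    simpa using hΛ 1 one_ne_zero
  have hlogh : ∀ {n : ℕ}, n ≠ 0 → LSeries.logMul h n = Λg n := by
    intro n hn
    rcases eq_or_ne n 1 with rfl | hn1
    · simp [LSeries.logMul, hΛ1]
    · have : Real.log n ≠ 0 := by
        have : (1 : ℝ) < n := by exact_mod_cast (by omega : 1 < n)
        exact (Real.log_pos this).ne'
      have hc : (Real.log n : ℂ) ≠ 0 := by exact_mod_cast this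
      simp only [LSeries.logMul, hh, natCast_log]
      rw [natCast_log] at hc
      field_simp
  have hlogg : ∀ {n : ℕ}, n ≠ 0 → LSeries.logMul g n = LSeries.convolution Λg g n := by
    intro n hn
    simp only [LSeries.convolution_def, LSeries.logMul]
    rw [← natCast_log, mul_comm, hconv n hn,
      Nat.sum_divisorsAntidiagonal (fun d e => Λg d * g e)]
  have hΛa : LSeries.abscissaOfAbsConv Λg ≤ 1 := by
    rw [← LSeries.abscissaOfAbsConv_congr hlogh, LSeries.abscissaOfAbsConv_logMul]
    exact hha
  have hder : ∀ z : ℂ, 1 < z.re →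
      HasDerivAt (fun z => LSeries g z * exp (-LSeries h z)) 0 z := by
    intro z hz
    have d1 := LSeries_hasDerivAt (hlt hg hz)
    have d2 := LSeries_hasDerivAt (hlt hha hz)
    rw [LSeries_congr hlogg, LSeries_convolution (hlt hΛa hz) (hlt hg hz)] at d1
    rw [LSeries_congr hlogh] at d2
    convert! d1.mul d2.neg.cexp using 1
    ring
  have hopen : IsOpen {z : ℂ | 1 < z.re} := isOpen_lt continuous_const continuous_re
  have hconst : ∀ z : ℂ, 1 < z.re →
      LSeries g z * exp (-LSeries h z) = LSeries g s * exp (-LSeries h s) := fun z hz =>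
    hopen.is_const_of_deriv_eq_zero (convex_halfSpace_re_gt 1).isPreconnected
      (fun w hw => (hder w hw).differentiableAt.differentiableWithinAt)
      (fun w hw => (hder w hw).deriv) hz hs
  have hlim : Filter.Tendsto (fun x : ℝ => LSeries g x * exp (-LSeries h x)) Filter.atTop
      (nhds 1) := by
    have t1 := LSeries.tendsto_atTop (hg.trans_lt (by exact_mod_cast EReal.coe_lt_top 1))
    have t2 := LSeries.tendsto_atTop (hha.trans_lt (by exact_mod_cast EReal.coe_lt_top 1))
    have := t1.mul ((continuous_exp.tendsto _).comp t2.neg)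
    simpa [hh, h1] using this
  have hone : LSeries g s * exp (-LSeries h s) = 1 := by
    refine tendsto_nhds_unique (tendsto_const_nhds.congr' ?_) hlim
    filter_upwards [Filter.eventually_gt_atTop (1 : ℝ)] with x hx
    exact (hconst x (by simpa using hx)).symm
  rw [exp_neg] at hone
  field_simp at hone
  simpa using hone

/-- All prime factors of `n` belong to `T`. -/
def PrimesIn (T : Set ℕ) (n : ℕ) : Prop := ∀ p ∈ n.primeFactors, p ∈ T

lemma primesIn_univ (n : ℕ) : PrimesIn Set.univ n := fun _ _ => Set.mem_univ _

lemma primesIn_one (T : Set ℕ) : PrimesIn T 1 := by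
  simp [PrimesIn]

lemma primesIn_mul {T : Set ℕ} {m n : ℕ} (hm : m ≠ 0) (hn : n ≠ 0) :
    PrimesIn T (m * n) ↔ PrimesIn T m ∧ PrimesIn T n := by
  simp only [PrimesIn, Nat.primeFactors_mul hm hn, Finset.mem_union]
  grind

lemma LSeries_sift_eq_exp {f Λf : ℕ → ℂ} {κ : ℝ} (hκ : 0 ≤ κ) (hf : IsHalaszClass κ f Λf)
    (T : Set ℕ) {q : ℕ} (χ : DirichletCharacter ℂ q) {s : ℂ} (hs : 1 < s.re) :
    LSeries (fun n => if PrimesIn T n then f n * χ n else 0) s =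
      exp (LSeries (fun n => (if PrimesIn T n then Λf n * χ n else 0) / Real.log n) s) := by
  refine LSeries_eq_exp_LSeries_div_log hκ ?_ ?_ ?_ ?_ hs
  · simp [primesIn_one, hf.map_one]
  · intro n hn
    split_ifs with h
    · rw [mul_right_comm, hf.conv n (Nat.one_le_iff_ne_zero.mpr hn), Finset.sum_mul]
      refine Finset.sum_congr rfl fun d hd => ?_
      have hdn := Nat.dvd_of_mem_divisors hd
      obtain ⟨e, rfl⟩ := hdn
      have hd0 : d ≠ 0 := left_ne_zero_of_mul hn
      have he0 : e ≠ 0 := right_ne_zero_of_mul hn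
      rw [primesIn_mul hd0 he0] at h
      rw [Nat.mul_div_cancel_left _ (Nat.pos_of_ne_zero hd0), if_pos h.1, if_pos h.2,
        Nat.cast_mul, map_mul]
      ring
    · rw [zero_mul]
      refine (Finset.sum_eq_zero fun d hd => ?_).symm
      obtain ⟨e, rfl⟩ := Nat.dvd_of_mem_divisors hd
      have hd0 : d ≠ 0 := left_ne_zero_of_mul hn
      have he0 : e ≠ 0 := right_ne_zero_of_mul hn
      rw [primesIn_mul hd0 he0] at h
      rw [Nat.mul_div_cancel_left _ (Nat.pos_of_ne_zero hd0)]
      by_cases h1 : PrimesIn T d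
      · rw [if_neg (fun h2 => h ⟨h1, h2⟩), mul_zero]
      · rw [if_neg h1, zero_mul]
  · refine LSeries.abscissaOfAbsConv_le_of_forall_lt_LSeriesSummable' fun σ hσ => ?_
    have hσ : 1 < σ := by exact_mod_cast hσ
    refine Summable.of_norm_bounded (hf.abs_conv σ hσ) fun n => ?_
    rw [LSeries.norm_term_eq]
    split_ifs with h0 h1
    · positivity
    · simp only [ofReal_re]
      gcongr
      rw [norm_mul]
      exact mul_le_of_le_one_right (norm_nonneg _) (χ.norm_le_one _)
    · simp only [norm_zero, zero_div]
      positivity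
  · intro n hn
    have := hf.bound n (Nat.one_le_iff_ne_zero.mpr hn)
    split_ifs with h
    · rw [norm_mul]
      exact (mul_le_of_le_one_right (norm_nonneg _) (χ.norm_le_one _)).trans this
    · rw [norm_zero]
      exact (norm_nonneg _).trans this

lemma isHalaszClass_one :
    IsHalaszClass 1 (fun _ => 1) (fun n => (ArithmeticFunction.vonMangoldt n : ℂ)) where
  map_one := rfl
  mult := by simp
  supp n hn := by simp [ArithmeticFunction.vonMangoldt_eq_zero_iff, hn]
  bound n _ := by
    simp [abs_of_nonneg ArithmeticFunction.vonMangoldt_nonneg]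
  conv n _ := by
    rw [one_mul, ← ArithmeticFunction.vonMangoldt_sum]
    simp
  abs_conv σ hσ := by
    simpa using Real.summable_one_div_nat_rpow.mpr hσ

/-- The coefficient `Λ(n) / log n`, restricted to the `n` composed of primes in `T`. -/
def logCoeff (T : Set ℕ) (n : ℕ) : ℝ :=
  if PrimesIn T n then ArithmeticFunction.vonMangoldt n / Real.log n else 0

/-- The logarithm of the partial Euler product over the primes in `T`, at a real point. -/
def logEuler (T : Set ℕ) (σ : ℝ) : ℝ := ∑' n : ℕ, logCoeff T n / (n : ℝ) ^ σ

/-- The logarithm of the Euler product of `χ` over the primes in `T`. -/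
def logEulerChar (T : Set ℕ) {q : ℕ} (χ : DirichletCharacter ℂ q) (s : ℂ) : ℂ :=
  LSeries (fun n => logCoeff T n * χ n) s

lemma logCoeff_nonneg (T : Set ℕ) (n : ℕ) : 0 ≤ logCoeff T n := by
  unfold logCoeff
  split_ifs
  · exact div_nonneg ArithmeticFunction.vonMangoldt_nonneg (Real.log_natCast_nonneg n)
  · exact le_rfl

lemma logCoeff_le_one (T : Set ℕ) (n : ℕ) : logCoeff T n ≤ 1 := by
  unfold logCoeff
  split_ifs
  · exact div_le_one_of_le₀ ArithmeticFunction.vonMangoldt_le_log (Real.log_natCast_nonneg n)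
  · exact zero_le_one

lemma logCoeff_zero (T : Set ℕ) : logCoeff T 0 = 0 := by
  simp [logCoeff]

lemma summable_logCoeff (T : Set ℕ) {σ : ℝ} (hσ : 1 < σ) :
    Summable fun n : ℕ => logCoeff T n / (n : ℝ) ^ σ := by
  refine Summable.of_nonneg_of_le (fun n => div_nonneg (logCoeff_nonneg T n) (by positivity))
    (fun n => ?_) (Real.summable_one_div_nat_rpow.mpr hσ)
  gcongr
  exact logCoeff_le_one T n

lemma norm_term_logCoeff_le (T : Set ℕ) {q : ℕ} (χ : DirichletCharacter ℂ q) (s : ℂ) (n : ℕ) :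
    ‖LSeries.term (fun n => logCoeff T n * χ n) s n‖ ≤ logCoeff T n / (n : ℝ) ^ s.re := by
  rw [LSeries.norm_term_eq]
  split_ifs with h0
  · exact div_nonneg (logCoeff_nonneg T n) (by positivity)
  · gcongr
    rw [norm_mul, norm_real, Real.norm_of_nonneg (logCoeff_nonneg T n)]
    exact mul_le_of_le_one_right (logCoeff_nonneg T n) (χ.norm_le_one _)

lemma LSeriesSummable_logCoeff (T : Set ℕ) {q : ℕ} (χ : DirichletCharacter ℂ q) {s : ℂ}
    (hs : 1 < s.re) : LSeriesSummable (fun n => logCoeff T n * χ n) s :=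
  Summable.of_norm_bounded (summable_logCoeff T hs) (norm_term_logCoeff_le T χ s)

lemma norm_logEulerChar_le (T : Set ℕ) {q : ℕ} (χ : DirichletCharacter ℂ q) {s : ℂ}
    (hs : 1 < s.re) : ‖logEulerChar T χ s‖ ≤ logEuler T s.re :=
  tsum_of_norm_bounded (summable_logCoeff T hs).hasSum (norm_term_logCoeff_le T χ s)

lemma logCoeff_add_compl (T : Set ℕ) (n : ℕ) :
    logCoeff T n + logCoeff Tᶜ n = logCoeff Set.univ n := by
  rcases eq_or_ne (ArithmeticFunction.vonMangoldt n) 0 with h | h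
  · simp [logCoeff, h]
  · rw [ArithmeticFunction.vonMangoldt_ne_zero_iff, isPrimePow_nat_iff] at h
    obtain ⟨p, k, hp, hk, rfl⟩ := h
    simp only [logCoeff, PrimesIn, Nat.primeFactors_prime_pow hk.ne' hp]
    by_cases hT : p ∈ T <;> simp [hT]

lemma logEuler_add_compl (T : Set ℕ) {σ : ℝ} (hσ : 1 < σ) :
    logEuler T σ + logEuler Tᶜ σ = logEuler Set.univ σ := by
  simp only [logEuler, ← logCoeff_add_compl T, add_div]
  exact ((summable_logCoeff T hσ).tsum_add (summable_logCoeff Tᶜ hσ)).symm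

lemma logEulerChar_add_compl (T : Set ℕ) {q : ℕ} (χ : DirichletCharacter ℂ q) {s : ℂ}
    (hs : 1 < s.re) :
    logEulerChar T χ s + logEulerChar Tᶜ χ s = logEulerChar Set.univ χ s := by
  rw [logEulerChar, logEulerChar, ← LSeries_add (LSeriesSummable_logCoeff T χ hs)
    (LSeriesSummable_logCoeff Tᶜ χ hs), logEulerChar]
  congr 1
  ext n
  rw [Pi.add_apply, ← logCoeff_add_compl T]
  push_cast
  ring

lemma exp_logEulerChar (T : Set ℕ) {q : ℕ} (χ : DirichletCharacter ℂ q) {s : ℂ}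
    (hs : 1 < s.re) :
    exp (logEulerChar T χ s) = LSeries (fun n => if PrimesIn T n then χ n else 0) s := by
  have := LSeries_sift_eq_exp zero_le_one isHalaszClass_one T χ hs
  simp only [one_mul] at this
  rw [this, logEulerChar]
  congr 2
  ext n
  unfold logCoeff
  split_ifs
  · push_cast
    ring
  · simp

lemma logEulerChar_univ_re {q : ℕ} [NeZero q] (χ : DirichletCharacter ℂ q) {s : ℂ}
    (hs : 1 < s.re) : (logEulerChar Set.univ χ s).re = Real.log ‖χ.LFunction s‖ := by
  rw [DirichletCharacter.LFunction_eq_LSeries χ hs]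
  have := exp_logEulerChar Set.univ χ hs
  simp only [primesIn_univ, if_true] at this
  rw [← this, norm_exp, Real.log_exp]

lemma logEulerChar_one (T : Set ℕ) (σ : ℝ) :
    logEulerChar T (1 : DirichletCharacter ℂ 1) σ = logEuler T σ := by
  rw [logEuler, ofReal_tsum]
  refine tsum_congr fun n => ?_
  rcases eq_or_ne n 0 with rfl | hn
  · simp [logCoeff_zero]
  · rw [LSeries.term_of_ne_zero hn, Subsingleton.elim (n : ZMod 1) 1, map_one, mul_one, ofReal_div,
      ofReal_cpow (Nat.cast_nonneg n), ofReal_natCast]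

lemma exp_logEuler (T : Set ℕ) {σ : ℝ} (hσ : 1 < σ) :
    Real.exp (logEuler T σ) = ∑' n : ℕ, (if n ≠ 0 ∧ PrimesIn T n then 1 / (n : ℝ) ^ σ else 0) := by
  apply ofReal_injective
  rw [ofReal_exp, ← logEulerChar_one T σ, exp_logEulerChar T _ (by simpa using hσ), ofReal_tsum]
  refine tsum_congr fun n => ?_
  rcases eq_or_ne n 0 with rfl | hn
  · simp
  · rw [LSeries.term_of_ne_zero hn, Subsingleton.elim (n : ZMod 1) 1, map_one]
    split_ifs <;> simp_all [ofReal_cpow]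

lemma Lchi_eq_exp {f Λf : ℕ → ℂ} {κ : ℝ} (hκ : 0 ≤ κ) (hf : IsHalaszClass κ f Λf) (y : ℝ)
    {q : ℕ} (χ : DirichletCharacter ℂ q) {s : ℂ} (hs : 1 < s.re) :
    Lchi f χ y s = exp (LSeries (fun n =>
      (if PrimesIn {p | y < p} n then Λf n * χ n else 0) / Real.log n) s) := by
  rw [← LSeries_sift_eq_exp hκ hf _ χ hs]
  refine tsum_congr fun n => ?_
  rcases eq_or_ne n 0 with rfl | hn
  · have : s ≠ 0 := by
      rintro rfl
      norm_num at hs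
    simp [this]
  · rw [LSeries.term_of_ne_zero hn]
    simp only [PrimesIn, Set.mem_ofPred_eq]
    congr

/-- The primes exceeding `y`. -/
def largePrimes (y : ℝ) : Set ℕ := {p | y < (p : ℝ)}

lemma primesIn_compl_largePrimes_of_le {y : ℝ} {n : ℕ} (hn : (n : ℝ) ≤ y) :
    PrimesIn (largePrimes y)ᶜ n := fun p hp =>
  not_lt.mpr (le_trans (by exact_mod_cast Nat.le_of_mem_primeFactors hp) hn)

lemma logEuler_univ_le {σ : ℝ} (hσ : 1 < σ) :
    logEuler Set.univ σ ≤ Real.log (1 + 1 / (σ - 1)) := by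
  have hpos : 0 < 1 / (σ - 1) := one_div_pos.mpr (by linarith)
  rw [Real.le_log_iff_exp_le (by linarith), exp_logEuler _ hσ]
  have hs : Summable fun n : ℕ => 1 / (n : ℝ) ^ σ := Real.summable_one_div_nat_rpow.mpr hσ
  calc ∑' n : ℕ, (if n ≠ 0 ∧ PrimesIn Set.univ n then 1 / (n : ℝ) ^ σ else 0)
      = ∑' n : ℕ, 1 / (n : ℝ) ^ σ := by
        refine tsum_congr fun n => ?_
        rcases eq_or_ne n 0 with rfl | hn
        · simp [Real.zero_rpow (by linarith : σ ≠ 0)]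
        · simp [hn, primesIn_univ]
    _ = ∑' n : ℕ, 1 / ((n : ℝ) + 1) ^ σ := by
        rw [hs.tsum_eq_zero_add]
        simp [Real.zero_rpow (by linarith : σ ≠ 0)]
    _ ≤ 1 + 1 / (σ - 1) := by
        have h1 := ZetaAsymptotics.zeta_limit_aux1 hσ
        have h2 : 0 ≤ ZetaAsymptotics.termTSum σ :=
          tsum_nonneg fun n => ZetaAsymptotics.term_nonneg _ _
        have h3 : 0 ≤ σ * ZetaAsymptotics.termTSum σ := mul_nonneg (by linarith) h2
        linarith

lemma le_logEuler_compl_largePrimes {σ y : ℝ} (hσ : 1 < σ) (hy : 1 < y) :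
    Real.log (Real.log y) - (σ - 1) * Real.log y ≤ logEuler (largePrimes y)ᶜ σ := by
  have hl : 0 < Real.log y := Real.log_pos hy
  rw [← Real.exp_le_exp, exp_logEuler _ hσ, Real.exp_sub, Real.exp_log hl, div_eq_mul_inv,
    ← Real.exp_neg]
  have hs : Summable fun n : ℕ => 1 / (n : ℝ) ^ σ := Real.summable_one_div_nat_rpow.mpr hσ
  set F : ℕ → ℝ := fun n =>
    if n ≠ 0 ∧ PrimesIn (largePrimes y)ᶜ n then 1 / (n : ℝ) ^ σ else 0 with hF
  have hF0 : ∀ n, 0 ≤ F n := fun n => by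
    simp only [hF]
    split_ifs <;> positivity
  have hFs : Summable F := by
    refine Summable.of_nonneg_of_le hF0 (fun n => ?_) hs
    simp only [hF]
    split_ifs
    · exact le_rfl
    · positivity
  calc Real.log y * Real.exp (-((σ - 1) * Real.log y))
      ≤ (∑ n ∈ Finset.Icc 1 ⌊y⌋₊, (n : ℝ)⁻¹) * Real.exp (-((σ - 1) * Real.log y)) := by
        gcongr
        have := log_le_harmonic_floor y (by linarith)
        rw [harmonic_eq_sum_Icc] at this
        simpa using this
    _ = ∑ n ∈ Finset.Icc 1 ⌊y⌋₊, (n : ℝ)⁻¹ * Real.exp (-((σ - 1) * Real.log y)) :=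
        Finset.sum_mul _ _ _
    _ ≤ ∑ n ∈ Finset.Icc 1 ⌊y⌋₊, F n := by
        refine Finset.sum_le_sum fun n hn => ?_
        rw [Finset.mem_Icc] at hn
        have hn0 : n ≠ 0 := by omega
        have hnpos : (0 : ℝ) < n := by exact_mod_cast hn.1
        have hny : (n : ℝ) ≤ y := (Nat.le_floor_iff (by linarith)).mp hn.2
        simp only [hF]
        rw [if_pos ⟨hn0, primesIn_compl_largePrimes_of_le hny⟩, one_div, ← Real.rpow_neg hnpos.le,
          Real.rpow_def_of_pos hnpos]
        nth_rewrite 1 [← Real.exp_log hnpos]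
        rw [← Real.exp_neg, ← Real.exp_add, Real.exp_le_exp]
        have := Real.log_le_log hnpos hny
        nlinarith
    _ ≤ ∑' n, F n := hFs.sum_le_tsum _ fun n _ => hF0 n

lemma logEuler_largePrimes_le {σ y : ℝ} (hσ : 1 < σ) (hy : 1 < y) :
    logEuler (largePrimes y) σ ≤
      Real.log (1 + 1 / (σ - 1)) - Real.log (Real.log y) + (σ - 1) * Real.log y := by
  linarith [logEuler_univ_le hσ, le_logEuler_compl_largePrimes hσ hy,
    logEuler_add_compl (largePrimes y) hσ]

lemma logEuler_anti (T : Set ℕ) {σ σ' : ℝ} (hσ : 1 < σ) (h : σ ≤ σ') :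
    logEuler T σ' ≤ logEuler T σ := by
  refine (summable_logCoeff T (hσ.trans_le h)).tsum_le_tsum (fun n => ?_) (summable_logCoeff T hσ)
  rcases eq_or_ne n 0 with rfl | hn
  · simp [logCoeff_zero]
  · have hn1 : (1 : ℝ) ≤ n := by exact_mod_cast Nat.one_le_iff_ne_zero.mpr hn
    have := logCoeff_nonneg T n
    gcongr

lemma sum_vonMangoldt_div_le {N : ℕ} (hN : 1 ≤ N) :
    ∑ n ∈ Finset.Ioc 0 N, ArithmeticFunction.vonMangoldt n / n ≤ 2 * Real.log N := by
  have hNpos : (0 : ℝ) < N := by exact_mod_cast hN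
  have key := ArithmeticFunction.sum_Ioc_mul_zeta_eq_sum ArithmeticFunction.vonMangoldt N
  rw [ArithmeticFunction.vonMangoldt_mul_zeta] at key
  have h1 : ∑ n ∈ Finset.Ioc 0 N, ArithmeticFunction.log n ≤ N * Real.log N := by
    calc ∑ n ∈ Finset.Ioc 0 N, ArithmeticFunction.log n
        ≤ ∑ n ∈ Finset.Ioc 0 N, Real.log N := by
          refine Finset.sum_le_sum fun n hn => ?_
          rw [Finset.mem_Ioc] at hn
          rw [ArithmeticFunction.log_apply]
          exact Real.log_le_log (by exact_mod_cast hn.1) (by exact_mod_cast hn.2)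
      _ = N * Real.log N := by simp
  have h2 : ∑ n ∈ Finset.Ioc 0 N, ArithmeticFunction.vonMangoldt n / n * (N / 2) ≤
      ∑ n ∈ Finset.Ioc 0 N, ArithmeticFunction.vonMangoldt n * ↑(N / n) := by
    refine Finset.sum_le_sum fun n hn => ?_
    rw [Finset.mem_Ioc] at hn
    have hn0 : (0 : ℝ) < n := by exact_mod_cast hn.1
    rw [div_mul_eq_mul_div, mul_div_assoc]
    refine mul_le_mul_of_nonneg_left ?_ ArithmeticFunction.vonMangoldt_nonneg
    rw [div_le_iff₀ hn0]
    have hm : 1 ≤ N / n := Nat.div_pos hn.2 hn.1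
    have hlt : N < n * (N / n + 1) := Nat.lt_mul_div_succ N hn.1
    have hlt' : (N : ℝ) < n * ((N / n : ℕ) + 1) := by exact_mod_cast hlt
    have hm' : (1 : ℝ) ≤ (N / n : ℕ) := by exact_mod_cast hm
    nlinarith
  rw [← Finset.sum_mul] at h2
  have h3 := h2.trans (key.symm.le.trans h1)
  nlinarith

lemma summable_vonMangoldt_nonprime_div :
    Summable fun n : ℕ => (if n.Prime then 0 else ArithmeticFunction.vonMangoldt n) / (n : ℝ) := by
  refine (ArithmeticFunction.vonMangoldt.summable_residueClass_non_primes_div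
    (0 : ZMod 1)).congr fun n => ?_
  congr 2
  exact Set.indicator_of_mem (s := {n : ℕ | (n : ZMod 1) = 0}) (Subsingleton.elim _ _)
    (fun n => ArithmeticFunction.vonMangoldt n)

/-- The smooth part of `∑ Λ(n) / n` is `O(log y)`. -/
lemma summable_and_tsum_smooth_vonMangoldt_div_le {y : ℝ} (hy : 1 ≤ y) :
    Summable (fun n : ℕ => (if PrimesIn (largePrimes y)ᶜ n then
      ArithmeticFunction.vonMangoldt n / (n : ℝ) else 0)) ∧
    ∑' n : ℕ, (if PrimesIn (largePrimes y)ᶜ n then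
      ArithmeticFunction.vonMangoldt n / (n : ℝ) else 0) ≤
      2 * Real.log y +
        ∑' n : ℕ, (if n.Prime then 0 else ArithmeticFunction.vonMangoldt n) / (n : ℝ) := by
  have hΛ : ∀ n : ℕ, 0 ≤ ArithmeticFunction.vonMangoldt n / (n : ℝ) := fun n =>
    div_nonneg ArithmeticFunction.vonMangoldt_nonneg (Nat.cast_nonneg n)
  set s := Finset.Ioc 0 ⌊y⌋₊ with hs
  set A : ℕ → ℝ := fun n =>
    if n ∈ s then ArithmeticFunction.vonMangoldt n / (n : ℝ) else 0 with hA
  have hAs : HasSum A (∑ n ∈ s, ArithmeticFunction.vonMangoldt n / (n : ℝ)) := by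
    rw [Finset.sum_congr rfl fun n hn => (if_pos hn).symm]
    exact hasSum_sum_of_ne_finset_zero fun n hn => if_neg hn
  have hB := summable_vonMangoldt_nonprime_div
  have hle : ∀ n : ℕ, (if PrimesIn (largePrimes y)ᶜ n then
      ArithmeticFunction.vonMangoldt n / (n : ℝ) else 0) ≤
      A n + (if n.Prime then 0 else ArithmeticFunction.vonMangoldt n) / (n : ℝ) := by
    intro n
    have hA0 : 0 ≤ A n := by
      simp only [hA]
      split_ifs
      · exact hΛ n
      · exact le_rfl
    by_cases hp : n.Prime
    · rw [if_pos hp, zero_div, add_zero]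
      split_ifs with h
      · have : n ∈ s := by
          rw [hs, Finset.mem_Ioc]
          refine ⟨hp.pos, (Nat.le_floor_iff (by linarith)).mpr ?_⟩
          simpa [largePrimes] using h n (by simp [hp])
        simp [hA, this]
      · exact hA0
    · rw [if_neg hp]
      split_ifs
      · linarith
      · linarith [hΛ n]
  have h0 : ∀ n : ℕ, 0 ≤ (if PrimesIn (largePrimes y)ᶜ n then
      ArithmeticFunction.vonMangoldt n / (n : ℝ) else 0) := fun n => by
    split_ifs
    · exact hΛ n
    · exact le_rfl
  have hsum := Summable.of_nonneg_of_le h0 hle (hAs.summable.add hB)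
  refine ⟨hsum, (hsum.tsum_le_tsum hle (hAs.summable.add hB)).trans ?_⟩
  rw [hAs.summable.tsum_add hB, hAs.tsum_eq]
  gcongr
  have hfl : 1 ≤ ⌊y⌋₊ := (Nat.one_le_floor_iff y).mpr hy
  refine (sum_vonMangoldt_div_le hfl).trans ?_
  gcongr
  exact Nat.floor_le (by linarith)

lemma norm_logEulerChar_smooth_sub_le {q : ℕ} (χ : DirichletCharacter ℂ q) {y σ σ₀ t : ℝ}
    (hy : 1 ≤ y) (hσ : 1 < σ) (h : σ ≤ σ₀) :
    ‖logEulerChar (largePrimes y)ᶜ χ (σ + t * I) - logEulerChar (largePrimes y)ᶜ χ (σ₀ + t * I)‖ ≤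
      (σ₀ - σ) * (2 * Real.log y +
        ∑' n : ℕ, (if n.Prime then 0 else ArithmeticFunction.vonMangoldt n) / (n : ℝ)) := by
  obtain ⟨h1, h2⟩ := summable_and_tsum_smooth_vonMangoldt_div_le hy
  have hs1 : 1 < ((σ : ℂ) + t * I).re := by simpa using hσ
  have hs2 : 1 < ((σ₀ : ℂ) + t * I).re := by simpa using hσ.trans_le h
  refine le_trans ?_ (mul_le_mul_of_nonneg_left h2 (by linarith))
  rw [logEulerChar, logEulerChar, LSeries, LSeries,
    ← (LSeriesSummable_logCoeff _ χ hs1).tsum_sub (LSeriesSummable_logCoeff _ χ hs2)]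
  refine tsum_of_norm_bounded (h1.hasSum.mul_left (σ₀ - σ)) fun n => ?_
  rcases eq_or_ne n 0 with rfl | hn
  · simp
  have hn1 : (1 : ℝ) ≤ n := by exact_mod_cast Nat.one_le_iff_ne_zero.mpr hn
  have hnpos : (0 : ℝ) < n := by linarith
  have hnc : (n : ℂ) ≠ 0 := by exact_mod_cast hn
  rw [LSeries.term_of_ne_zero hn, LSeries.term_of_ne_zero hn, div_eq_mul_inv, div_eq_mul_inv,
    ← mul_sub, norm_mul, norm_mul, norm_real, Real.norm_of_nonneg (logCoeff_nonneg _ n)]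
  have hdiff : ‖((n : ℂ) ^ ((σ : ℂ) + t * I))⁻¹ - ((n : ℂ) ^ ((σ₀ : ℂ) + t * I))⁻¹‖ ≤
      (σ₀ - σ) * Real.log n / n := by
    rw [cpow_add _ _ hnc, cpow_add _ _ hnc, mul_inv, mul_inv, ← sub_mul, norm_mul,
      norm_inv ((n : ℂ) ^ (_ * I)), norm_natCast_cpow_of_pos (Nat.pos_of_ne_zero hn)]
    have : ((n : ℂ) ^ (σ : ℂ))⁻¹ - ((n : ℂ) ^ (σ₀ : ℂ))⁻¹ =
        (((n : ℝ) ^ σ)⁻¹ - ((n : ℝ) ^ σ₀)⁻¹ : ℝ) := by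
      push_cast [ofReal_cpow hnpos.le]
      rfl
    rw [this, norm_real]
    have hre : ((t : ℂ) * I).re = 0 := by simp
    rw [hre, Real.rpow_zero, inv_one, mul_one]
    have hmono : (n : ℝ) ^ σ ≤ (n : ℝ) ^ σ₀ := Real.rpow_le_rpow_of_exponent_le hn1 h
    have hpos : 0 < (n : ℝ) ^ σ := Real.rpow_pos_of_pos hnpos σ
    rw [Real.norm_of_nonneg (sub_nonneg.mpr (inv_anti₀ hpos hmono))]
    have hn' : ((n : ℝ) ^ σ)⁻¹ ≤ (n : ℝ)⁻¹ := by
      refine inv_anti₀ hnpos ?_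
      simpa using Real.rpow_le_rpow_of_exponent_le hn1 hσ.le
    have hratio : ((n : ℝ) ^ σ₀)⁻¹ = ((n : ℝ) ^ σ)⁻¹ * Real.exp (-(Real.log n * (σ₀ - σ))) := by
      rw [← Real.rpow_neg hnpos.le, ← Real.rpow_neg hnpos.le, Real.rpow_def_of_pos hnpos,
        Real.rpow_def_of_pos hnpos, ← Real.exp_add]
      congr 1
      ring
    have hexp := Real.add_one_le_exp (-(Real.log n * (σ₀ - σ)))
    have hL : 0 ≤ Real.log n * (σ₀ - σ) := mul_nonneg (Real.log_nonneg hn1) (by linarith)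
    calc ((n : ℝ) ^ σ)⁻¹ - ((n : ℝ) ^ σ₀)⁻¹
        = ((n : ℝ) ^ σ)⁻¹ * (1 - Real.exp (-(Real.log n * (σ₀ - σ)))) := by rw [hratio]; ring
      _ ≤ ((n : ℝ) ^ σ)⁻¹ * (Real.log n * (σ₀ - σ)) := by gcongr; linarith
      _ ≤ (n : ℝ)⁻¹ * (Real.log n * (σ₀ - σ)) := by gcongr
      _ = (σ₀ - σ) * Real.log n / n := by ring
  have hbd : logCoeff (largePrimes y)ᶜ n * (Real.log n / n) ≤
      if PrimesIn (largePrimes y)ᶜ n then ArithmeticFunction.vonMangoldt n / (n : ℝ) else 0 := by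
    unfold logCoeff
    split_ifs
    · rcases eq_or_ne (Real.log n) 0 with h0 | h0
      · rw [h0]
        simpa using div_nonneg ArithmeticFunction.vonMangoldt_nonneg hnpos.le
      · exact le_of_eq (by field_simp)
    · simp
  calc logCoeff (largePrimes y)ᶜ n * ‖χ n‖ *
        ‖((n : ℂ) ^ ((σ : ℂ) + t * I))⁻¹ - ((n : ℂ) ^ ((σ₀ : ℂ) + t * I))⁻¹‖
      ≤ logCoeff (largePrimes y)ᶜ n * 1 * ((σ₀ - σ) * Real.log n / n) := by
        have := logCoeff_nonneg (largePrimes y)ᶜ n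
        gcongr
        exact χ.norm_le_one _
    _ = (σ₀ - σ) * (logCoeff (largePrimes y)ᶜ n * (Real.log n / n)) := by ring
    _ ≤ _ := mul_le_mul_of_nonneg_left hbd (by linarith)

lemma two_le_log_of_ten_le {x : ℝ} (hx : 10 ≤ x) : 2 ≤ Real.log x := by
  rw [Real.le_log_iff_exp_le (by linarith), show (2 : ℝ) = 1 + 1 by norm_num, Real.exp_add]
  have h1 := Real.exp_one_lt_d9
  have h2 := Real.exp_pos 1
  nlinarith

/-- Just to the right of the line `Re s = 1`, the size of `L(s, χ)` is controlled by its size a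
little further to the right. -/
lemma log_norm_LFunction_le {q : ℕ} [NeZero q] {χ : DirichletCharacter ℂ q} (hχ : χ ≠ 1)
    {B σ σ₀ t : ℝ} (hB : 2 * q * (3 / 2 + |t|) ≤ B) (hσ : 1 < σ) (h : σ ≤ σ₀)
    (hσ₀ : σ₀ ≤ 1 + 1 / 8) :
    Real.log ‖χ.LFunction (σ + t * I)‖ - Real.log B ≤
      (1 - 16 * (σ₀ - σ)) * (Real.log ‖χ.LFunction (σ₀ + t * I)‖ - Real.log B) := by
  have hq : (0 : ℝ) < q := by exact_mod_cast NeZero.pos q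
  have ht := abs_nonneg t
  have hBpos : 0 < B := lt_of_lt_of_le (by positivity) hB
  set G : ℂ → ℂ := fun z => χ.LFunction (1 + t * I + z) / B with hG
  have hne : ∀ {s : ℂ}, 1 ≤ s.re → χ.LFunction s ≠ 0 := fun hs =>
    DirichletCharacter.LFunction_ne_zero_of_one_le_re _ (Or.inl hχ) hs
  have hlogG : ∀ {ρ : ℝ}, 1 < ρ →
      Real.log ‖G ((ρ - 1 : ℝ) : ℂ)‖ = Real.log ‖χ.LFunction (ρ + t * I)‖ - Real.log B := by
    intro ρ hρ
    have harg : (1 + t * I + ((ρ - 1 : ℝ) : ℂ) : ℂ) = ρ + t * I := by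
      push_cast
      ring
    simp only [hG]
    rw [harg, norm_div, norm_real, Real.norm_of_nonneg hBpos.le, Real.log_div
      (norm_ne_zero_iff.mpr (hne (by simpa using hρ.le))) hBpos.ne']
  have hdiff : Differentiable ℂ G :=
    ((DirichletCharacter.differentiable_LFunction hχ).comp
      (differentiable_const (1 + t * I)|>.add differentiable_id)).div_const _
  have key := log_norm_le_of_zeros_left (G := G) (R := 1 / 2) (a := σ - 1) (b := σ₀ - 1)
    (by norm_num) (fun z _ => hdiff.analyticAt z) ?_ ?_ (by linarith) (by linarith) (by linarith)
  · rw [hlogG hσ, hlogG (hσ.trans_le h)] at key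
    convert! key using 2
    ring
  · intro z hz
    rw [mem_closedBall_zero_iff] at hz
    have hre := (abs_le.mp ((abs_re_le_norm z).trans hz)).1
    simp only [hG]
    rw [norm_div, norm_real, Real.norm_of_nonneg hBpos.le, div_le_one hBpos]
    refine (norm_LFunction_le hχ (by simp; linarith)).trans (le_trans ?_ hB)
    gcongr
    calc ‖1 + t * I + z‖ ≤ ‖(1 : ℂ)‖ + ‖(t : ℂ) * I‖ + ‖z‖ := norm_add₃_le
      _ ≤ 3 / 2 + |t| := by
        simp only [norm_one, norm_mul, norm_real, norm_I, mul_one, Real.norm_eq_abs]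
        linarith
  · intro z _ hz0
    by_contra! hpos
    rw [div_eq_zero_iff] at hz0
    rcases hz0 with h0 | h0
    · exact hne (by simpa using hpos.le) h0
    · exact hBpos.ne' (by exact_mod_cast h0)

/-- For nonprincipal `χ` the logarithm of the Euler product over primes beyond `q log x` is bounded
above to the right of `Re s = 1`. -/
lemma exists_re_logEulerChar_largePrimes_le {κ : ℝ} (hκ : 0 < κ) :
    ∃ C : ℝ, 0 < C ∧ ∀ (q : ℕ) [NeZero q] (χ : DirichletCharacter ℂ q), χ ≠ 1 →
      ∀ x y σ t : ℝ, 10 ≤ x → q * Real.log x ≤ y → 1 < σ → |t| ≤ 2 * Real.log x ^ κ →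
      (logEulerChar (largePrimes y) χ (σ + t * I)).re ≤ C := by
  set c₀ := ∑' n : ℕ, (if n.Prime then 0 else ArithmeticFunction.vonMangoldt n) / (n : ℝ) with hc₀
  have hc₀nn : 0 ≤ c₀ := tsum_nonneg fun n => by
    have := ArithmeticFunction.vonMangoldt_nonneg (n := n)
    split_ifs <;> positivity
  refine ⟨39 + κ + c₀, by positivity, ?_⟩
  intro q _ χ hχ x y σ t hx hy hσ ht
  have hq1 : (1 : ℝ) ≤ q := by exact_mod_cast NeZero.one_le
  have hX := two_le_log_of_ten_le hx
  set X := Real.log x with hXdef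
  have hXy : X ≤ y := le_trans (by nlinarith) hy
  have hqy : (q : ℝ) ≤ y := le_trans (by nlinarith) hy
  have hy2 : 2 ≤ y := hX.trans hXy
  set l := Real.log y with hl
  have hl2 : Real.log 2 ≤ l := Real.log_le_log two_pos hy2
  have hlhalf : 1 / 2 ≤ l := by linarith [Real.log_two_gt_d9]
  have hlpos : 0 < l := by linarith
  set b := 1 / (16 * l) with hb
  have hbpos : 0 < b := by positivity
  have hbl : b * l = 1 / 16 := by
    rw [hb]
    field_simp
  have hb8 : b ≤ 1 / 8 := by nlinarith
  have hrough : logEuler (largePrimes y) (1 + b) ≤ 18 := by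
    have h1 := logEuler_largePrimes_le (σ := 1 + b) (y := y) (by linarith) (by linarith)
    rw [show 1 + b - 1 = b by ring, ← hl, hbl, hb, one_div_one_div] at h1
    have h2 : Real.log (1 + 16 * l) ≤ Real.log (18 * l) :=
      Real.log_le_log (by positivity) (by linarith)
    rw [Real.log_mul (by norm_num) hlpos.ne'] at h2
    have h3 := Real.log_le_sub_one_of_pos (show (0 : ℝ) < 18 by norm_num)
    linarith
  have hre : ∀ {ρ : ℝ}, 1 < ρ → (logEulerChar (largePrimes y) χ (ρ + t * I)).re ≤
      logEuler (largePrimes y) ρ := by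
    intro ρ hρ
    have := norm_logEulerChar_le (largePrimes y) χ (s := ρ + t * I) (by simpa using hρ)
    exact (re_le_norm _).trans (by simpa using this)
  rcases le_total (1 + b) σ with hσb | hσb
  · linarith [hre hσ, logEuler_anti (largePrimes y) (show 1 < 1 + b by linarith) hσb]
  have hXκ : 1 ≤ X ^ κ := Real.one_le_rpow (by linarith) hκ.le
  have hu := log_norm_LFunction_le hχ (B := 8 * (q * X ^ κ)) (t := t)
    (by nlinarith) hσ hσb (by linarith)
  have hM : Real.log (8 * (q * X ^ κ)) ≤ (4 + κ) * l := by
    rw [Real.log_mul (by norm_num) (by positivity), Real.log_mul (by positivity) (by positivity),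
      Real.log_rpow (by linarith), show (8 : ℝ) = 2 ^ (3 : ℕ) by norm_num, Real.log_pow]
    have h1 : Real.log q ≤ l := Real.log_le_log (by linarith) hqy
    have h2 : Real.log X ≤ l := Real.log_le_log (by linarith) hXy
    push_cast
    nlinarith
  set s : ℂ := σ + t * I with hs
  set s₀ : ℂ := (1 + b : ℝ) + t * I with hs₀
  have hsre : 1 < s.re := by simpa [hs] using hσ
  have hs₀re : 1 < s₀.re := by simpa [hs₀] using hbpos
  rw [← logEulerChar_univ_re χ hsre, ← logEulerChar_univ_re χ hs₀re] at hu
  have hu₀ : -(logEulerChar Set.univ χ s₀).re ≤ 16 * l := by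
    have h1 := norm_logEulerChar_le Set.univ χ hs₀re
    have h2 : s₀.re = 1 + b := by simp [hs₀]
    have h3 := logEuler_univ_le (σ := 1 + b) (by linarith)
    rw [show 1 + b - 1 = b by ring, hb, one_div_one_div] at h3
    have h4 := Real.log_le_sub_one_of_pos (show 0 < 1 + 16 * l by positivity)
    rw [h2, hb] at h1
    linarith [(abs_le.mp (abs_re_le_norm (logEulerChar Set.univ χ s₀))).1]
  have hsplit := congrArg re (logEulerChar_add_compl (largePrimes y) χ hsre)
  have hsplit₀ := congrArg re (logEulerChar_add_compl (largePrimes y) χ hs₀re)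
  rw [add_re] at hsplit hsplit₀
  have hsm := norm_logEulerChar_smooth_sub_le χ (t := t) (show 1 ≤ y by linarith) hσ hσb
  rw [← hs, ← hs₀, ← hl, ← hc₀] at hsm
  have hsm' := (abs_le.mp ((abs_re_le_norm _).trans hsm)).1
  rw [sub_re] at hsm'
  have hsm_le : (1 + b - σ) * (2 * l + c₀) ≤ 1 / 8 + c₀ := by nlinarith
  have hrough₀ := hre (show 1 < 1 + b by linarith)
  rw [← hs₀] at hrough₀
  have hθ : 16 * (1 + b - σ) * (Real.log (8 * (q * X ^ κ)) - (logEulerChar Set.univ χ s₀).re) ≤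
      20 + κ := by
    calc 16 * (1 + b - σ) * (Real.log (8 * (q * X ^ κ)) - (logEulerChar Set.univ χ s₀).re)
        ≤ 16 * (1 + b - σ) * ((20 + κ) * l) := by
          refine mul_le_mul_of_nonneg_left ?_ (by linarith)
          linarith
      _ ≤ 16 * b * ((20 + κ) * l) := by
          refine mul_le_mul_of_nonneg_right (by linarith) (by positivity)
      _ = 20 + κ := by linear_combination (16 * (20 + κ)) * hbl
  nlinarith

lemma conj_natCast_cpow (n : ℕ) (w : ℂ) :
    (starRingEnd ℂ) ((n : ℂ) ^ w) = (n : ℂ) ^ ((starRingEnd ℂ) w) := by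
  rw [cpow_conj _ _ (by rw [natCast_arg]; exact Real.pi_pos.ne), conj_natCast]

lemma logCoeff_mul_conj_eq_term (T : Set ℕ) {q : ℕ} [NeZero q] (χ ψ : DirichletCharacter ℂ q)
    (σ : ℝ) (w z : ℂ) {n : ℕ} (hn : n ≠ 0) :
    ((logCoeff T n / (n : ℝ) ^ σ : ℝ) : ℂ) *
      (χ n * (n : ℂ) ^ (-w) * (starRingEnd ℂ) (ψ n * (n : ℂ) ^ (-z))) =
    LSeries.term (fun n => logCoeff T n * (χ * ψ⁻¹) n) (σ + w + (starRingEnd ℂ) z) n := by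
  have hnc : (n : ℂ) ≠ 0 := by exact_mod_cast hn
  have hstar : (starRingEnd ℂ) (ψ n) = ψ⁻¹ n := MulChar.star_apply' ψ _
  rw [LSeries.term_of_ne_zero hn, map_mul, hstar, conj_natCast_cpow, map_neg, MulChar.mul_apply,
    cpow_neg, cpow_neg, cpow_add _ _ hnc, cpow_add _ _ hnc, ofReal_div,
    ofReal_cpow (Nat.cast_nonneg n), ofReal_natCast]
  field_simp

lemma normSq_sum_eq_sum_re {ι : Type*} [Fintype ι] (v : ι → ℂ) :
    ‖∑ j, v j‖ ^ 2 = ∑ j, ∑ k, (v j * (starRingEnd ℂ) (v k)).re := by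
  rw [← normSq_eq_norm_sq, ← ofReal_re (normSq _), ← mul_conj, map_sum, Finset.sum_mul_sum,
    re_sum]
  simp only [re_sum]

/-- The large-sieve type identity for the mean square of a sum of twists. -/
lemma hasSum_logCoeff_mul_normSq (T : Set ℕ) {q : ℕ} [NeZero q] {ι : Type*} [Fintype ι]
    (χ : ι → DirichletCharacter ℂ q) {σ : ℝ} (hσ : 1 < σ) (w : ι → ℂ) (hw : ∀ j, 0 ≤ (w j).re) :
    HasSum (fun n : ℕ => logCoeff T n / (n : ℝ) ^ σ * ‖∑ j, χ j n * (n : ℂ) ^ (-w j)‖ ^ 2)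
      (∑ j, ∑ k, (logEulerChar T (χ j * (χ k)⁻¹) (σ + w j + (starRingEnd ℂ) (w k))).re) := by
  have hterm : ∀ n : ℕ, logCoeff T n / (n : ℝ) ^ σ * ‖∑ j, χ j n * (n : ℂ) ^ (-w j)‖ ^ 2 =
      ∑ j, ∑ k, (LSeries.term (fun n => logCoeff T n * (χ j * (χ k)⁻¹) n)
        (σ + w j + (starRingEnd ℂ) (w k)) n).re := by
    intro n
    rcases eq_or_ne n 0 with rfl | hn
    · simp [logCoeff_zero]
    · rw [normSq_sum_eq_sum_re, Finset.mul_sum]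
      refine Finset.sum_congr rfl fun j _ => ?_
      rw [Finset.mul_sum]
      refine Finset.sum_congr rfl fun k _ => ?_
      rw [← logCoeff_mul_conj_eq_term T _ _ _ _ _ hn, re_ofReal_mul]
  simp only [hterm]
  refine hasSum_sum fun j _ => hasSum_sum fun k _ => hasSum_re ?_
  refine (LSeriesSummable_logCoeff T _ ?_).hasSum
  simp only [add_re, ofReal_re, conj_re]
  linarith [hw j, hw k]

lemma sum_log_norm_Lchi_le {κ : ℝ} (hκ : 0 < κ) {f Λf : ℕ → ℂ} (hf : IsHalaszClass κ f Λf)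
    {q : ℕ} [NeZero q] {J : ℕ} (hJ : 1 ≤ J) (χ : Fin J → DirichletCharacter ℂ q) (y : ℝ) {σ : ℝ}
    (hσ : 1 < σ) (w : Fin J → ℂ) (hw : ∀ j, 0 ≤ (w j).re) :
    ∑ j, Real.log ‖Lchi f (χ j) y (σ + w j)‖ ≤
      κ * (√J / 2 * logEuler (largePrimes y) σ + 1 / (2 * √J) * ∑ j, ∑ k,
        (logEulerChar (largePrimes y) (χ j * (χ k)⁻¹) (σ + w j + (starRingEnd ℂ) (w k))).re) := by
  set T := largePrimes y with hT
  have hs : ∀ j, 1 < (σ + w j).re := fun j => by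
    simp only [add_re, ofReal_re]
    linarith [hw j]
  set F : Fin J → ℕ → ℂ := fun j n =>
    (if PrimesIn T n then Λf n * χ j n else 0) / Real.log n with hF
  set V : ℕ → ℂ := fun n => ∑ j, χ j n * (n : ℂ) ^ (-w j) with hV
  have hlog : ∀ j, Real.log ‖Lchi f (χ j) y (σ + w j)‖ = (LSeries (F j) (σ + w j)).re := by
    intro j
    rw [Lchi_eq_exp hκ.le hf y (χ j) (hs j), norm_exp, Real.log_exp]
    rfl
  have hFs : ∀ j, LSeriesSummable (F j) (σ + w j) := by
    intro j
    refine LSeriesSummable_of_abscissaOfAbsConv_lt_re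
      (lt_of_le_of_lt (abscissaOfAbsConv_div_log_le hκ.le fun n hn => ?_)
        (by exact_mod_cast hs j))
    have := hf.bound n (Nat.one_le_iff_ne_zero.mpr hn)
    split_ifs with h
    · rw [norm_mul]
      exact (mul_le_of_le_one_right (norm_nonneg _) ((χ j).norm_le_one _)).trans this
    · rw [norm_zero]
      exact (norm_nonneg _).trans this
  have hJ0 : (0 : ℝ) < J := by exact_mod_cast hJ
  have hJs : 0 < √(J : ℝ) := Real.sqrt_pos.mpr hJ0
  have hbound : ∀ n : ℕ, ‖∑ j, LSeries.term (F j) (σ + w j) n‖ ≤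
      κ * (√J / 2 * (logCoeff T n / (n : ℝ) ^ σ) +
        1 / (2 * √J) * (logCoeff T n / (n : ℝ) ^ σ * ‖V n‖ ^ 2)) := by
    intro n
    rcases eq_or_ne n 0 with rfl | hn
    · simp [logCoeff_zero]
    have hnc : (n : ℂ) ≠ 0 := by exact_mod_cast hn
    have hnpos : (0 : ℝ) < n := by exact_mod_cast Nat.pos_of_ne_zero hn
    have hfac : ∑ j, LSeries.term (F j) (σ + w j) n =
        (if PrimesIn T n then Λf n else 0) / Real.log n / (n : ℂ) ^ (σ : ℂ) * V n := by
      rw [hV, Finset.mul_sum]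
      refine Finset.sum_congr rfl fun j _ => ?_
      rw [LSeries.term_of_ne_zero hn, cpow_add _ _ hnc, cpow_neg]
      simp only [hF]
      split_ifs
      · field_simp
      · simp
    have hα : 0 ≤ logCoeff T n / (n : ℝ) ^ σ := div_nonneg (logCoeff_nonneg T n) (by positivity)
    have hcoef : ‖(if PrimesIn T n then Λf n else 0) / Real.log n / (n : ℂ) ^ (σ : ℂ)‖ ≤
        κ * (logCoeff T n / (n : ℝ) ^ σ) := by
      have hl := Real.log_natCast_nonneg n
      rw [norm_div, norm_div, norm_real, Real.norm_of_nonneg hl,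
        norm_natCast_cpow_of_pos (Nat.pos_of_ne_zero hn), ofReal_re, ← mul_div_assoc]
      gcongr
      unfold logCoeff
      split_ifs
      · rw [← mul_div_assoc]
        gcongr
        exact hf.bound n (Nat.one_le_iff_ne_zero.mpr hn)
      · simp
    have hamgm : ‖V n‖ ≤ √J / 2 + 1 / (2 * √J) * ‖V n‖ ^ 2 := by
      have : 0 ≤ (√J - ‖V n‖) ^ 2 / (2 * √J) := by positivity
      have h2 : (√J - ‖V n‖) ^ 2 / (2 * √J) = √J / 2 + 1 / (2 * √J) * ‖V n‖ ^ 2 - ‖V n‖ := by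
        field_simp
        ring
      linarith
    rw [hfac, norm_mul]
    calc _ ≤ κ * (logCoeff T n / (n : ℝ) ^ σ) * (√J / 2 + 1 / (2 * √J) * ‖V n‖ ^ 2) := by
          gcongr
      _ = _ := by ring
  have hsum := (((summable_logCoeff T hσ).hasSum.mul_left (√J / 2)).add
    ((hasSum_logCoeff_mul_normSq T χ hσ w hw).mul_left (1 / (2 * √J)))).mul_left κ
  calc ∑ j, Real.log ‖Lchi f (χ j) y (σ + w j)‖
      = (∑ j, LSeries (F j) (σ + w j)).re := by
        rw [re_sum]
        exact Finset.sum_congr rfl fun j _ => hlog j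
    _ ≤ ‖∑ j, LSeries (F j) (σ + w j)‖ := re_le_norm _
    _ = ‖∑' n, ∑ j, LSeries.term (F j) (σ + w j) n‖ := by
        rw [Summable.tsum_finsetSum fun j _ => hFs j]
        rfl
    _ ≤ _ := tsum_of_norm_bounded hsum hbound

lemma logEuler_largePrimes_le_log_div {x y : ℝ} (hx : 10 ≤ x) (hy : 1 < y) (hyx : y ≤ √x) :
    logEuler (largePrimes y) (1 + 1 / Real.log x) ≤ Real.log (Real.log x / Real.log y) + 2 := by
  have hX := two_le_log_of_ten_le hx
  have hl : 0 < Real.log y := Real.log_pos hy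
  have hlX : Real.log y ≤ Real.log x / 2 := by
    rw [← Real.log_sqrt (by linarith)]
    exact Real.log_le_log (by linarith) hyx
  have hpos : 0 < 1 / Real.log x := by positivity
  have h := logEuler_largePrimes_le (σ := 1 + 1 / Real.log x) (by linarith) hy
  rw [add_sub_cancel_left, one_div_one_div] at h
  have h1 : Real.log (1 + Real.log x) ≤ Real.log (2 * Real.log x) :=
    Real.log_le_log (by linarith) (by linarith)
  rw [Real.log_mul (by norm_num) (by linarith)] at h1
  have h2 : 1 / Real.log x * Real.log y ≤ 1 / 2 := by
    rw [one_div_mul_eq_div, div_le_iff₀ (by linarith)]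
    linarith
  rw [Real.log_div (by linarith) hl.ne']
  linarith [Real.log_two_lt_d9]

theorem repulsion_twists (κ : ℝ) (hκ : 0 < κ) :
    ∃ C : ℝ, 0 < C ∧ ∀ f Λf : ℕ → ℂ, IsHalaszClass κ f Λf →
    ∀ q : ℕ, 1 ≤ q → ∀ J : ℕ, 1 ≤ J →
    ∀ χ : Fin J → DirichletCharacter ℂ q, Function.Injective χ →
    ∀ t δ : Fin J → ℝ, ∀ x y : ℝ, 10 ≤ x →
      (q : ℝ) * Real.log x ≤ y → y ≤ Real.sqrt x →
      (∀ j, |t j| ≤ Real.log x ^ κ) →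
      (∀ j, 0 ≤ δ j) →
      ∃ j, Real.log
          ‖Lchi f (χ j) y (((1 + 1 / Real.log x + δ j : ℝ) : ℂ) + (t j : ℂ) * Complex.I)‖ ≤
        κ / Real.sqrt (J : ℝ) * (Real.log (Real.log x / Real.log y) + C * (J : ℝ)) := by
  obtain ⟨C, hC, hpair⟩ := exists_re_logEulerChar_largePrimes_le hκ
  refine ⟨2 + C, by positivity, ?_⟩
  intro f Λf hf q hq J hJ χ hχ t δ x y hx hy hyx ht hδ
  have : NeZero q := ⟨by omega⟩
  have : Nonempty (Fin J) := ⟨⟨0, hJ⟩⟩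
  have hX := two_le_log_of_ten_le hx
  have hq1 : (1 : ℝ) ≤ q := by exact_mod_cast hq
  have hy1 : 1 < y := by nlinarith
  have hJ1 : (1 : ℝ) ≤ J := by exact_mod_cast hJ
  have hJs : 0 < √(J : ℝ) := Real.sqrt_pos.mpr (by linarith)
  set σ := 1 + 1 / Real.log x with hσdef
  have hσ : 1 < σ := by
    have : 0 < 1 / Real.log x := by positivity
    linarith
  set S := logEuler (largePrimes y) σ with hS
  have hSle : S ≤ Real.log (Real.log x / Real.log y) + 2 :=
    logEuler_largePrimes_le_log_div hx hy1 hyx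
  set w : Fin J → ℂ := fun j => δ j + t j * I with hw
  have hwre : ∀ j, (w j).re = δ j := fun j => by simp [hw]
  have hmain := sum_log_norm_Lchi_le hκ hf hJ χ y hσ w fun j => by
    rw [hwre]
    exact hδ j
  have hentry : ∀ j k, (logEulerChar (largePrimes y) (χ j * (χ k)⁻¹)
      (σ + w j + (starRingEnd ℂ) (w k))).re ≤ (if j = k then S else 0) + C := by
    intro j k
    have harg : (σ + w j + (starRingEnd ℂ) (w k) : ℂ) =
        ((σ + δ j + δ k : ℝ) : ℂ) + ((t j - t k : ℝ) : ℂ) * I := by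
      simp only [hw, map_add, map_mul, conj_ofReal, conj_I]
      push_cast
      ring
    have hσ' : 1 < σ + δ j + δ k := by linarith [hδ j, hδ k]
    rw [harg]
    split_ifs with hjk
    · have h1 := norm_logEulerChar_le (largePrimes y) (χ j * (χ k)⁻¹)
        (s := ((σ + δ j + δ k : ℝ) : ℂ) + ((t j - t k : ℝ) : ℂ) * I) (by simpa using hσ')
      have h2 := logEuler_anti (largePrimes y) hσ (show σ ≤ σ + δ j + δ k by linarith [hδ j, hδ k])
      have h3 : (((σ + δ j + δ k : ℝ) : ℂ) + ((t j - t k : ℝ) : ℂ) * I).re = σ + δ j + δ k := by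
        simp
      rw [h3] at h1
      linarith [re_le_norm (logEulerChar (largePrimes y) (χ j * (χ k)⁻¹)
        (((σ + δ j + δ k : ℝ) : ℂ) + ((t j - t k : ℝ) : ℂ) * I))]
    · rw [zero_add]
      refine hpair q _ (fun h => hjk (hχ ?_)) x y _ _ hx hy hσ' ?_
      · exact mul_inv_eq_one.mp h
      · exact (abs_sub _ _).trans (by linarith [ht j, ht k])
  have hdouble : ∑ j, ∑ k, (logEulerChar (largePrimes y) (χ j * (χ k)⁻¹)
      (σ + w j + (starRingEnd ℂ) (w k))).re ≤ J * S + J * (J * C) := by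
    refine (Finset.sum_le_sum fun j _ => Finset.sum_le_sum fun k _ => hentry j k).trans ?_
    simp [Finset.sum_add_distrib]
  obtain ⟨j, _, hj⟩ := Finset.exists_le_of_sum_le (s := Finset.univ)
    (f := fun j => Real.log ‖Lchi f (χ j) y (σ + w j)‖)
    (g := fun _ => κ / √J * (Real.log (Real.log x / Real.log y) + (2 + C) * J))
    Finset.univ_nonempty (by
      refine hmain.trans ?_
      rw [Finset.sum_const, Finset.card_univ, Fintype.card_fin, nsmul_eq_mul]
      have hsq : √(J : ℝ) * √J = J := Real.mul_self_sqrt (by linarith)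
      calc _ ≤ κ * (√J / 2 * S + 1 / (2 * √J) * (J * S + J * (J * C))) := by gcongr
        _ = J * (κ / √J * (S + J * C / 2)) := by
          field_simp
          rw [Real.sq_sqrt (by linarith)]
          ring
        _ ≤ _ := by
          gcongr ?_ * (?_ * ?_)
          nlinarith)
  refine ⟨j, ?_⟩
  convert! hj using 4
  simp only [hw]
  push_cast
  ring
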